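/- Let F be a field, C₂ ⊆ C₁ ⊆ F^{m×n} nested linear codes and L ⊆ F^n a subspace. Then (dim(C₁) − dim(C₁ ∩ V_{L^⊥})) − (dim(C₂) − dim(C₂ ∩ V_{L^⊥})) = dim(C₂^⊥ ∩ V_L) − dim(C₁^⊥ ∩ V_L). -/

import Mathlib

noncomputable section

open Matrix

variable {F : Type*} [Field F]

/-- The row space of a matrix: the span of its rows. -/
def rowSpace {m n : ℕ} (C : Matrix (Fin m) (Fin n) F) : Submodule F (Fin n → F) :=
  Submodule.span F (Set.range C)

/-- The rank support space of a subspace `L ⊆ F^n`: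
all `m × n` matrices whose row space is contained in `L`. -/
def rss (m : ℕ) {n : ℕ} (L : Submodule F (Fin n → F)) :
    Submodule F (Matrix (Fin m) (Fin n) F) where
  carrier := {V | rowSpace V ≤ L}
  add_mem' := by
    intro a b ha hb
    simp only [Set.mem_setOf_eq, rowSpace, Submodule.span_le] at *
    rintro x ⟨i, rfl⟩
    exact L.add_mem (ha (Set.mem_range_self i)) (hb (Set.mem_range_self i))
  zero_mem' := by
    simp only [Set.mem_setOf_eq, rowSpace, Submodule.span_le]
    rintro x ⟨i, rfl⟩
    exact L.zero_mem
  smul_mem' := by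
    intro c a ha
    simp only [Set.mem_setOf_eq, rowSpace, Submodule.span_le] at *
    rintro x ⟨i, rfl⟩
    exact L.smul_mem c (ha (Set.mem_range_self i))

/-- The dual of a space of matrices under the trace (Hilbert–Schmidt) product
`⟨C, D⟩ = Trace (C * Dᵀ)`. -/
def traceDual {m n : ℕ} (C : Submodule F (Matrix (Fin m) (Fin n) F)) :
    Submodule F (Matrix (Fin m) (Fin n) F) where
  carrier := {D | ∀ C' ∈ C, Matrix.trace (C' * D.transpose) = 0}
  add_mem' := by
    intro a b ha hb C' hC'
    simp [Matrix.transpose_add, Matrix.mul_add, Matrix.trace_add, ha C' hC', hb C' hC']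
  zero_mem' := by
    intro C' hC'
    simp
  smul_mem' := by
    intro c a ha C' hC'
    simp [Matrix.transpose_smul, Matrix.mul_smul, Matrix.trace_smul, ha C' hC']

/-- The orthogonal of a subspace of `F^n` under the standard bilinear form. -/
def dualL {n : ℕ} (L : Submodule F (Fin n → F)) : Submodule F (Fin n → F) where
  carrier := {w | ∀ v ∈ L, ∑ i, v i * w i = 0}
  add_mem' := by
    intro a b ha hb v hv
    have : ∑ i, v i * (a + b) i = (∑ i, v i * a i) + ∑ i, v i * b i := by
      rw [← Finset.sum_add_distrib]
      exact Finset.sum_congr rfl fun i _ => mul_add _ _ _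
    rw [this, ha v hv, hb v hv, add_zero]
  zero_mem' := by
    intro v hv
    simp
  smul_mem' := by
    intro c a ha v hv
    have : ∑ i, v i * (c • a) i = c * ∑ i, v i * a i := by
      rw [Finset.mul_sum]
      exact Finset.sum_congr rfl fun i _ => by simp [Pi.smul_apply, smul_eq_mul]; ring
    rw [this, ha v hv, mul_zero]

/-- The trace product `⟨C, D⟩ = Trace (C * Dᵀ)` as a bilinear form. -/
def traceProduct (F : Type*) [Field F] (m n : ℕ) :
    LinearMap.BilinForm F (Matrix (Fin m) (Fin n) F) :=
  LinearMap.mk₂ F (fun C D => Matrix.trace (C * D.transpose))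
    (by simp [Matrix.add_mul]) (by simp)
    (by simp [Matrix.mul_add]) (by simp)

theorem traceProduct_apply {m n : ℕ} (C D : Matrix (Fin m) (Fin n) F) :
    traceProduct F m n C D = Matrix.trace (C * D.transpose) := rfl

theorem traceProduct_isSymm (m n : ℕ) : (traceProduct F m n).IsSymm :=
  ⟨fun C D => by
    simp only [traceProduct_apply]
    rw [← Matrix.trace_transpose, Matrix.transpose_mul, Matrix.transpose_transpose]⟩

theorem traceProduct_nondegenerate (m n : ℕ) : (traceProduct F m n).Nondegenerate := by
  refine LinearMap.BilinForm.Nondegenerate.ofSeparatingLeft fun C hC => ?_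
  refine Matrix.ext_iff_trace_mul_right.2 fun D => ?_
  simpa [traceProduct_apply] using hC D.transpose

theorem orthogonal_traceProduct {m n : ℕ} (C : Submodule F (Matrix (Fin m) (Fin n) F)) :
    (traceProduct F m n).orthogonal C = traceDual C := rfl

theorem mem_rss {m n : ℕ} {L : Submodule F (Fin n → F)} {V : Matrix (Fin m) (Fin n) F} :
    V ∈ rss m L ↔ ∀ i, V i ∈ L := by
  change rowSpace V ≤ L ↔ _
  rw [rowSpace, Submodule.span_le]
  exact Set.range_subset_iff

theorem traceDual_rss (m : ℕ) {n : ℕ} (L : Submodule F (Fin n → F)) :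
    traceDual (rss m L) = rss m (dualL L) := by
  ext D
  rw [mem_rss]
  have trace_eq (C : Matrix (Fin m) (Fin n) F) :
      Matrix.trace (C * D.transpose) = ∑ i, ∑ j, C i j * D i j := by
    simp [Matrix.trace, Matrix.mul_apply]
  constructor
  · intro hD i v hv
    have h := hD (Matrix.updateRow 0 i v) (mem_rss.2 fun k => by
      obtain rfl | hk := eq_or_ne k i
      · simpa using hv
      · rw [Matrix.updateRow_ne hk]
        exact L.zero_mem)
    rw [trace_eq, Finset.sum_eq_single i (fun k _ hk => by simp [Matrix.updateRow_ne hk])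
      (by simp)] at h
    simpa using h
  · intro hD C hC
    rw [trace_eq]
    exact Finset.sum_eq_zero fun i _ => hD i _ (mem_rss.1 hC i)

theorem traceDual_traceDual {m n : ℕ} (C : Submodule F (Matrix (Fin m) (Fin n) F)) :
    traceDual (traceDual C) = C :=
  LinearMap.BilinForm.orthogonal_orthogonal (B := traceProduct F m n)
    (traceProduct_nondegenerate m n) (traceProduct_isSymm m n).isRefl C

theorem traceDual_sup {m n : ℕ} (C D : Submodule F (Matrix (Fin m) (Fin n) F)) :
    traceDual (C ⊔ D) = traceDual C ⊓ traceDual D := by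
  refine le_antisymm (le_inf (fun X hX Y hY => hX Y (Submodule.mem_sup_left hY))
    fun X hX Y hY => hX Y (Submodule.mem_sup_right hY)) fun X hX Y hY => ?_
  obtain ⟨c, hc, d, hd, rfl⟩ := Submodule.mem_sup.1 hY
  rw [Matrix.add_mul, Matrix.trace_add, hX.1 c hc, hX.2 d hd, add_zero]

theorem finrank_add_finrank_traceDual {m n : ℕ} (C : Submodule F (Matrix (Fin m) (Fin n) F)) :
    Module.finrank F C + Module.finrank F (traceDual C) =
      Module.finrank F (Matrix (Fin m) (Fin n) F) := by
  have h := LinearMap.BilinForm.finrank_add_finrank_orthogonal' (B := traceProduct F m n) C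
  rwa [(traceProduct_nondegenerate m n).ker_eq_bot, inf_bot_eq, finrank_bot, add_zero,
    orthogonal_traceProduct] at h

theorem finrank_add_finrank_rss_dualL {m n : ℕ} (C : Submodule F (Matrix (Fin m) (Fin n) F))
    (L : Submodule F (Fin n → F)) :
    Module.finrank F C + Module.finrank F (rss m (dualL L)) +
        Module.finrank F ↥(traceDual C ⊓ rss m L) =
      Module.finrank F (Matrix (Fin m) (Fin n) F) +
        Module.finrank F ↥(C ⊓ rss m (dualL L)) := by
  have h := finrank_add_finrank_traceDual (C ⊔ rss m (dualL L))
  rw [traceDual_sup, ← traceDual_rss, traceDual_traceDual, traceDual_rss] at h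
  have := Submodule.finrank_sup_add_finrank_inf_eq C (rss m (dualL L))
  lia

/-- For nested linear codes `C₂ ⊆ C₁ ⊆ F^{m×n}` and a subspace `L ⊆ F^n`,
`(dim C₁ - dim(C₁ ∩ V_{L^⊥})) - (dim C₂ - dim(C₂ ∩ V_{L^⊥}))
  = dim(C₂^⊥ ∩ V_L) - dim(C₁^⊥ ∩ V_L)`. -/
theorem stmt_7 (m n : ℕ) (C₁ C₂ : Submodule F (Matrix (Fin m) (Fin n) F)) (h21 : C₂ ≤ C₁)
    (L : Submodule F (Fin n → F)) :
    ((Module.finrank F ↥C₁ : ℤ) - (Module.finrank F ↥(C₁ ⊓ rss m (dualL L)) : ℤ))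
      - ((Module.finrank F ↥C₂ : ℤ) - (Module.finrank F ↥(C₂ ⊓ rss m (dualL L)) : ℤ))
      = (Module.finrank F ↥(traceDual C₂ ⊓ rss m L) : ℤ)
        - (Module.finrank F ↥(traceDual C₁ ⊓ rss m L) : ℤ) := by
  have h₁ := finrank_add_finrank_rss_dualL C₁ L
  have h₂ := finrank_add_finrank_rss_dualL C₂ L
  lia

end
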